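/- arXiv:2407.16093 — 2 statements merged into one kernel-verified Lean document; each statement's English description precedes it below -/
import Mathlib

section
/- Conditioned second-order deletion-constriction: let A, B ⊆ X × X be disjoint sets neither of which contains +1 = (a,b) or −1 = (b,a). Then for every vertex x ∈ X, r(b,a) · τ_b^{∖A ∥ B∪{+1}} · τ_x^{∖ A∪{+1,−1} ∥B} = r(a,b) · τ_a^{∖ A∪{+1,−1} ∥B} · τ_x^{∖ A∪{+1} ∥ B∪{−1}} + r(b,a) · τ_b^{∖ A∪{+1,−1} ∥B} · τ_x^{∖ A∪{−1} ∥ B∪{+1}}. -/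
open scoped Classical

noncomputable section

/-- A rooted spanning tree with root `x`: a map `t : X → X` fixing `x` such that every
vertex reaches `x` under iteration of `t`. -/
def IsRootedTree {X : Type*} (x : X) (t : X → X) : Prop :=
  t x = x ∧ ∀ y : X, ∃ n : ℕ, t^[n] y = x

/-- The edge set of a rooted spanning tree: `{(y, t y) : y ≠ x}`. -/
def treeEdges {X : Type*} (x : X) (t : X → X) : Set (X × X) :=
  {p : X × X | p.1 ≠ x ∧ p.2 = t p.1}

/-- The weight of a rooted spanning tree: `∏_{y ≠ x} r (y, t y)`. -/
def treeWeight {X : Type*} [Fintype X] (r : X × X → ℝ) (x : X) (t : X → X) : ℝ :=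
  ∏ y ∈ Finset.univ.filter (fun y => y ≠ x), r (y, t y)

/-- The conditioned rooted spanning-tree polynomial `τ_x^{∖A ∥B}`: the sum of weights of
rooted spanning trees with root `x` avoiding all edges of `A` and containing all edges of `B`. -/
def tau {X : Type*} [Fintype X] (r : X × X → ℝ) (x : X) (A B : Set (X × X)) : ℝ :=
  ∑ t : X → X,
    if IsRootedTree x t ∧ treeEdges x t ∩ A = ∅ ∧ B ⊆ treeEdges x t
    then treeWeight r x t else 0

/-- Irreducibility: between any two distinct vertices there is a directed path of
present (positive-rate) edges. -/
def Irreducible' {X : Type*} (r : X × X → ℝ) : Prop :=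
  ∀ x y : X, x ≠ y → ∃ (n : ℕ) (f : ℕ → X),
    f 0 = x ∧ f n = y ∧ ∀ i < n, 0 < r (f i, f (i + 1))

/-- `x` is reached from `v` by iterating `h`. -/
def Reach {X : Type*} (h : X → X) (v x : X) : Prop := ∃ n : ℕ, h^[n] v = x

/-- Forests with root set `R`. -/
def For {X : Type*} (R : Finset X) (h : X → X) : Prop :=
  (∀ x ∈ R, h x = x) ∧ ∀ v, ∃ x ∈ R, Reach h v x

/-- Weight of a forest. -/
def W {X : Type*} [Fintype X] (s : X × X → ℝ) (R : Finset X) (h : X → X) : ℝ :=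
  ∏ y ∈ Finset.univ.filter (fun y => y ∉ R), s (y, h y)

/-- Sum over forests with roots `R ∪ {x}` with `a` in the tree of `x`. -/
def Fo {X : Type*} [Fintype X] (s : X × X → ℝ) (R : Finset X) (x a : X) : ℝ :=
  ∑ g : X → X, if g x = x ∧ (For (insert x R) g ∧ Reach g a x) then W s (insert x R) g else 0

/-- Sum over forests with roots `R`. -/
def FR {X : Type*} [Fintype X] (s : X × X → ℝ) (R : Finset X) : ℝ :=
  ∑ g : X → X, if For R g then W s R g else 0

/-- Green function. -/
def NN {X : Type*} [Fintype X] (s : X × X → ℝ) (R : Finset X) (a x : X) : ℝ :=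
  if x ∈ R then 0 else Fo s R x a

theorem Reach.refl {X : Type*} (h : X → X) (v : X) : Reach h v v := ⟨0, rfl⟩

theorem Reach.trans {X : Type*} {h : X → X} {u v w : X} (h1 : Reach h u v) (h2 : Reach h v w) :
    Reach h u w := by
  obtain ⟨n, rfl⟩ := h1
  obtain ⟨m, rfl⟩ := h2
  exact ⟨m + n, Function.iterate_add_apply h m n u⟩

theorem Reach.step {X : Type*} (h : X → X) (v : X) : Reach h v (h v) := ⟨1, rfl⟩

theorem Reach.of_fixed {X : Type*} {h : X → X} {v w : X} (hv : h v = v) (h1 : Reach h v w) :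
    w = v := by
  obtain ⟨n, rfl⟩ := h1
  exact Function.iterate_fixed hv n

/-- A vertex lying on a cycle and reaching a fixed point is that fixed point. -/
theorem Reach.cycle {X : Type*} {h : X → X} {v z : X} (hz : h z = z) (h1 : Reach h (h v) v)
    (h2 : Reach h v z) : v = z := by
  obtain ⟨k, hk⟩ := h1
  obtain ⟨n, hn⟩ := h2
  have hk' : h^[k+1] v = v := by rw [Function.iterate_succ_apply]; exact hk
  have : (h^[k+1])^[n] v = v := Function.iterate_fixed hk' n
  rw [← Function.iterate_mul] at this
  have e : (k+1) * n = k * n + n := by ring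
  rw [e, Function.iterate_add_apply, hn, Function.iterate_fixed hz] at this
  exact this.symm

theorem reach_update {X : Type*} (h : X → X) (x c : X) (S : Finset X) (hx : x ∈ S) (v : X)
    (H : ∃ z ∈ S, Reach h v z) : ∃ z ∈ S, Reach (Function.update h x c) v z := by
  obtain ⟨z, hz, n, hn⟩ := H
  induction n generalizing v with
  | zero => exact ⟨z, hz, 0, hn⟩
  | succ n ih =>
    by_cases hv : v = x
    · subst hv; exact ⟨v, hx, Reach.refl _ _⟩
    · obtain ⟨w, hw, hr⟩ := ih (h v) (by rw [← hn, Function.iterate_succ_apply])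
      refine ⟨w, hw, Reach.trans ?_ hr⟩
      have := Reach.step (Function.update h x c) v
      rwa [Function.update_of_ne hv] at this

theorem reach_update_iff {X : Type*} (h : X → X) (x c : X) (S : Finset X) (hx : x ∈ S) (v : X) :
    (∃ z ∈ S, Reach (Function.update h x c) v z) ↔ ∃ z ∈ S, Reach h v z := by
  refine ⟨fun H => ?_, reach_update h x c S hx v⟩
  have := reach_update _ x (h x) S hx v H
  simpa using this

theorem reach_update_self {X : Type*} (h : X → X) (x c v : X) :
    Reach (Function.update h x c) v x ↔ Reach h v x := by
  have := reach_update_iff h x c {x} (by simp) v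
  simpa using this

theorem for_update {X : Type*} (h : X → X) (x : X) (R : Finset X) (hx : x ∉ R) :
    For (insert x R) (Function.update h x x) ↔
      (∀ z ∈ R, h z = z) ∧ ∀ v, ∃ z ∈ insert x R, Reach h v z := by
  unfold For
  simp only [reach_update_iff h x x (insert x R) (Finset.mem_insert_self _ _)]
  refine and_congr_left fun _ => ?_
  constructor
  · intro H z hz
    have := H z (Finset.mem_insert_of_mem hz)
    rwa [Function.update_of_ne (by rintro rfl; exact hx hz)] at this
  · intro H z hz
    by_cases hzx : z = x
    · subst hzx; simp
    · rw [Function.update_of_ne hzx]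
      exact H z (Finset.mem_of_mem_insert_of_ne hz hzx)

theorem W_insert {X : Type*} [Fintype X] (s : X × X → ℝ) (R : Finset X) (x : X) (hx : x ∉ R)
    (h : X → X) : W s R h = s (x, h x) * W s (insert x R) h := by
  unfold W
  have : Finset.univ.filter (fun y => y ∉ R) =
      insert x (Finset.univ.filter (fun y => y ∉ insert x R)) := by
    ext y; simp only [Finset.mem_filter, Finset.mem_univ, true_and, Finset.mem_insert, not_or]
    by_cases hy : y = x
    · subst hy; simp [hx]
    · simp [hy]
  rw [this, Finset.prod_insert (by simp)]

theorem W_congr {X : Type*} [Fintype X] (s s' : X × X → ℝ) (R : Finset X) (h h' : X → X)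
    (H : ∀ y, y ∉ R → s (y, h y) = s' (y, h' y)) : W s R h = W s' R h' := by
  unfold W
  exact Finset.prod_congr rfl fun y hy => H y (by simpa using hy)

theorem reroot {X : Type*} [Fintype X] (s : X × X → ℝ) (R : Finset X) (x y : X) (hx : x ∉ R)
    (P : (X → X) → Prop) :
    (∑ g : X → X, if g x = x ∧ P g then W s (insert x R) g else 0) * s (x, y) =
      ∑ h : X → X, if h x = y ∧ P (Function.update h x x) then W s R h else 0 := by
  rw [Finset.sum_mul]
  simp only [ite_mul, zero_mul]
  rw [← Finset.sum_filter, ← Finset.sum_filter]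
  refine Finset.sum_nbij' (fun g => Function.update g x y) (fun h => Function.update h x x)
    ?_ ?_ ?_ ?_ ?_
  · intro g hg
    simp only [Finset.mem_filter, Finset.mem_univ, true_and] at hg ⊢
    refine ⟨by simp, ?_⟩
    rw [Function.update_idem]
    nth_rewrite 2 [← hg.1]
    rw [Function.update_eq_self]
    exact hg.2
  · intro h hh
    simp only [Finset.mem_filter, Finset.mem_univ, true_and] at hh ⊢
    exact ⟨by simp, hh.2⟩
  · intro g hg
    simp only [Finset.mem_filter, Finset.mem_univ, true_and] at hg ⊢
    rw [Function.update_idem]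
    nth_rewrite 2 [← hg.1]
    rw [Function.update_eq_self]
  · intro h hh
    simp only [Finset.mem_filter, Finset.mem_univ, true_and] at hh ⊢
    rw [Function.update_idem, ← hh.1, Function.update_eq_self]
  · intro g hg
    rw [W_insert s R x hx, mul_comm]
    congr 1
    · simp
    · apply W_congr
      intro z hz
      rw [Function.update_of_ne (by rintro rfl; simp at hz)]

/-- The vertex condition for the predecessor. -/
def CC {X : Type*} (R : Finset X) (a y x : X) (h : X → X) : Prop :=
  h x = y ∧ ((∀ z ∈ R, h z = z) ∧ (∀ v, ∃ z ∈ insert x R, Reach h v z)) ∧ Reach h a x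

theorem Fo_mul {X : Type*} [Fintype X] (s : X × X → ℝ) (R : Finset X) (x y a : X) (hx : x ∉ R) :
    Fo s R x a * s (x, y) = ∑ h : X → X, if CC R a y x h then W s R h else 0 := by
  have hR := reroot s R x y hx (fun g => For (insert x R) g ∧ Reach g a x)
  have hFo : Fo s R x a = ∑ g : X → X,
      if g x = x ∧ (fun g => For (insert x R) g ∧ Reach g a x) g
        then W s (insert x R) g else 0 := by
    unfold Fo
    refine Finset.sum_congr rfl fun g _ => ?_
    congr 1
  refine Eq.trans ?_ (hR.trans ?_)
  · rw [hFo]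
    congr!
  · refine Finset.sum_congr rfl fun h _ => ?_
    simp only [for_update h x R hx, reach_update_self]
    congr 1

theorem Fo_mul_sum {X : Type*} [Fintype X] (s : X × X → ℝ) (R : Finset X) (y a : X) (hy : y ∉ R) :
    Fo s R y a * ∑ z, s (y, z) = ∑ h : X → X, if CC R a (h y) y h then W s R h else 0 := by
  rw [Finset.mul_sum]
  simp only [Fo_mul s R y _ a hy]
  rw [Finset.sum_comm]
  refine Finset.sum_congr rfl fun h _ => ?_
  rw [Finset.sum_eq_single (h y)]
  · intro z _ hz
    rw [if_neg]
    rintro ⟨h1, _⟩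
    exact hz h1.symm
  · simp

/-- Uniqueness and existence of the predecessor. -/
theorem pred_unique {X : Type*} (R : Finset X) (a y : X) (hy : y ∉ R) (h : X → X)
    (H : CC R a (h y) y h) (H' : ¬ (y = a ∧ For R h)) :
    ∃! x, x ∉ R ∧ CC R a y x h := by
  obtain ⟨_, ⟨hR, hv⟩, ha⟩ := H
  have notR : ∀ x, h x = y → x ∉ R := by
    intro x hx hxR
    rw [hR x hxR] at hx
    exact hy (hx ▸ hxR)
  by_cases hyR : ∃ z ∈ R, Reach h y z
  · have hF : For R h := by
      refine ⟨hR, fun v => ?_⟩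
      obtain ⟨z, hz, hr⟩ := hv v
      rcases Finset.mem_insert.1 hz with rfl | hz
      · obtain ⟨w, hw, hr'⟩ := hyR
        exact ⟨w, hw, hr.trans hr'⟩
      · exact ⟨z, hz, hr⟩
    have hya : y ≠ a := fun e => H' ⟨e, hF⟩
    have nocyc : ¬ Reach h (h y) y := by
      intro hc
      obtain ⟨z, hz, hr⟩ := hyR
      have := Reach.cycle (hR z hz) hc hr
      exact hy (this ▸ hz)
    obtain ⟨n, hn⟩ := ha
    obtain _ | n := n
    · exact absurd hn.symm hya
    rw [Function.iterate_succ_apply'] at hn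
    have key : ∀ p q : ℕ, h (h^[p] a) = y → h (h^[q] a) = y → p ≤ q → p = q := by
      intro p q hp hq hpq
      by_contra hne
      obtain ⟨d, rfl⟩ : ∃ d, q = d + (p + 1) := ⟨q - (p+1), by omega⟩
      rw [Function.iterate_add_apply, Function.iterate_succ_apply', hp] at hq
      apply nocyc
      refine ⟨d, ?_⟩
      rw [← Function.iterate_succ_apply, Function.iterate_succ_apply', hq]
    refine ⟨h^[n] a, ⟨notR _ hn, hn, ⟨hR, fun v => ?_⟩, ⟨n, rfl⟩⟩, ?_⟩
    · obtain ⟨z, hz, hr⟩ := hF.2 v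
      exact ⟨z, Finset.mem_insert_of_mem hz, hr⟩
    · rintro x' ⟨_, hx', _, ⟨m, rfl⟩⟩
      rcases le_total n m with hnm | hnm
      · rw [key n m hn hx' hnm]
      · rw [key m n hx' hn hnm]
  · have hcyc : Reach h (h y) y := by
      obtain ⟨z, hz, hr⟩ := hv (h y)
      rcases Finset.mem_insert.1 hz with rfl | hz
      · exact hr
      · exact absurd ⟨z, hz, (Reach.step h y).trans hr⟩ hyR
    obtain ⟨k, hk⟩ := hcyc
    have hk' : h (h^[k] y) = y := by
      rw [← Function.iterate_succ_apply' h k y, Function.iterate_succ_apply]; exact hk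
    refine ⟨h^[k] y, ⟨notR _ hk', hk', ⟨hR, fun v => ?_⟩, ha.trans ⟨k, rfl⟩⟩, ?_⟩
    · obtain ⟨z, hz, hr⟩ := hv v
      rcases Finset.mem_insert.1 hz with rfl | hz
      · exact ⟨_, Finset.mem_insert_self _ _, hr.trans ⟨k, rfl⟩⟩
      · exact ⟨z, Finset.mem_insert_of_mem hz, hr⟩
    · rintro x' ⟨_, hx', ⟨_, hv'⟩, _⟩
      obtain ⟨z, hz, hr⟩ := hv' y
      rcases Finset.mem_insert.1 hz with rfl | hz
      · obtain ⟨j, rfl⟩ := hr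
        have e1 : h^[k+1] y = y := by rw [Function.iterate_succ_apply']; exact hk'
        have e2 : h^[j+1] y = y := by rw [Function.iterate_succ_apply']; exact hx'
        have e3 : h^[j + (k+1)] y = h^[j] y := by rw [Function.iterate_add_apply, e1]
        have e4 : h^[k + (j+1)] y = h^[k] y := by rw [Function.iterate_add_apply, e2]
        rw [← e3, ← e4]
        congr 1; omega
      · exact absurd ⟨z, hz, hr⟩ hyR

theorem pred_imp {X : Type*} (R : Finset X) (a y x : X) (h : X → X)
    (H : CC R a y x h) : CC R a (h y) y h := by
  obtain ⟨hx, ⟨hR, hv⟩, ha⟩ := H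
  have hxy : Reach h x y := hx ▸ Reach.step h x
  refine ⟨rfl, ⟨hR, fun v => ?_⟩, ha.trans hxy⟩
  obtain ⟨z, hz, hr⟩ := hv v
  rcases Finset.mem_insert.1 hz with rfl | hz
  · exact ⟨_, Finset.mem_insert_self _ _, hr.trans hxy⟩
  · exact ⟨z, Finset.mem_insert_of_mem hz, hr⟩

theorem balance {X : Type*} [Fintype X] (s : X × X → ℝ) (R : Finset X) (y a : X) (hy : y ∉ R) :
    ∑ x, NN s R a x * s (x, y) + (if y = a then FR s R else 0) =
      NN s R a y * ∑ z, s (y, z) := by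
  have e1 : ∀ x, NN s R a x * s (x, y) =
      ∑ h : X → X, if x ∉ R ∧ CC R a y x h then W s R h else 0 := by
    intro x
    unfold NN
    by_cases hx : x ∈ R
    · simp [hx]
    · simp only [hx, if_false, not_false_eq_true, true_and]
      exact Fo_mul s R x y a hx
  have e2 : (if y = a then FR s R else 0) =
      ∑ h : X → X, if y = a ∧ For R h then W s R h else 0 := by
    unfold FR
    by_cases h : y = a <;> simp [h]
  have e3 : NN s R a y = Fo s R y a := by simp [NN, hy]
  rw [e3, Fo_mul_sum s R y a hy, e2, Finset.sum_congr rfl fun x _ => e1 x, Finset.sum_comm,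
    ← Finset.sum_add_distrib]
  refine Finset.sum_congr rfl fun h _ => ?_
  by_cases hF : y = a ∧ For R h
  · obtain ⟨rfl, hF⟩ := hF
    rw [Finset.sum_eq_zero]
    · rw [if_pos ⟨rfl, hF⟩, if_pos, zero_add]
      refine ⟨rfl, ⟨hF.1, fun v => ?_⟩, Reach.refl _ _⟩
      obtain ⟨z, hz, hr⟩ := hF.2 v
      exact ⟨z, Finset.mem_insert_of_mem hz, hr⟩
    · intro x _
      rw [if_neg]
      rintro ⟨_, hx, _, hr⟩
      obtain ⟨z, hz, hz'⟩ := hF.2 x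
      have : x = z := Reach.cycle (hF.1 z hz) (by rw [hx]; exact hr) hz'
      subst this
      exact hy (by rw [← hx, hF.1 _ hz]; exact hz)
  · rw [if_neg hF, add_zero]
    by_cases hC : CC R a (h y) y h
    · rw [if_pos hC]
      obtain ⟨x, hx, hu⟩ := pred_unique R a y hy h hC hF
      rw [Finset.sum_eq_single x, if_pos hx]
      · intro z _ hz
        rw [if_neg]
        exact fun hh => hz (hu z hh)
      · simp
    · rw [if_neg hC]
      refine Finset.sum_eq_zero fun x _ => ?_
      rw [if_neg]
      exact fun hh => hC (pred_imp R a y x h hh.2)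

/-- Flux into the root. -/
theorem flux {X : Type*} [Fintype X] (s : X × X → ℝ) (a b : X) (hab : a ≠ b) :
    ∑ x, NN s {b} a x * s (x, b) = FR s {b} := by
  have h1 : ∑ y ∈ Finset.univ.erase b,
      (∑ x, NN s {b} a x * s (x, y) + (if y = a then FR s {b} else 0)) =
      ∑ y ∈ Finset.univ.erase b, NN s {b} a y * ∑ z, s (y, z) :=
    Finset.sum_congr rfl fun y hy => balance s {b} y a (by simpa using hy)
  rw [Finset.sum_add_distrib, Finset.sum_ite_eq' (Finset.univ.erase b) a,
    if_pos (by simpa using hab)] at h1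
  have h2 := Finset.add_sum_erase Finset.univ
    (fun y => ∑ x, NN s {b} a x * s (x, y)) (Finset.mem_univ b)
  have h3 := Finset.add_sum_erase Finset.univ
    (fun y => NN s {b} a y * ∑ z, s (y, z)) (Finset.mem_univ b)
  have h4 : ∑ y, ∑ x, NN s {b} a x * s (x, y) = ∑ y, NN s {b} a y * ∑ z, s (y, z) := by
    rw [Finset.sum_comm]
    simp only [Finset.mul_sum]
  have h5 : NN s {b} a b = 0 := by simp [NN]
  simp only [h5, zero_mul, zero_add] at h3
  linarith

/-- Tree polynomial. -/
def TT {X : Type*} [Fintype X] (s : X × X → ℝ) (x : X) : ℝ := FR s {x}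

theorem TT_eq {X : Type*} [Fintype X] (s : X × X → ℝ) (x a : X) : TT s x = NN s ∅ a x := by
  unfold TT NN FR Fo
  simp only [Finset.notMem_empty, if_false, insert_empty_eq]
  refine Finset.sum_congr rfl fun g _ => ?_
  congr 1
  apply propext
  constructor
  · intro h
    refine ⟨h.1 x (by simp), h, ?_⟩
    obtain ⟨z, hz, hr⟩ := h.2 a
    rw [Finset.mem_singleton] at hz
    exact hz ▸ hr
  · exact fun h => h.2.1

theorem mctt {X : Type*} [Fintype X] (s : X × X → ℝ) (y : X) :
    ∑ x, TT s x * s (x, y) = TT s y * ∑ z, s (y, z) := by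
  have := balance s ∅ y y (by simp)
  have h0 : FR s ∅ = 0 := by
    unfold FR
    refine Finset.sum_eq_zero fun g _ => ?_
    rw [if_neg]
    intro h
    obtain ⟨z, hz, _⟩ := h.2 y
    simp at hz
  simp only [h0, ite_self, add_zero] at this
  simp only [TT_eq s _ y]
  exact this

theorem FR_pair {X : Type*} [Fintype X] (s : X × X → ℝ) (a b : X) (hab : a ≠ b) :
    NN s {b} a a = FR s {a, b} := by
  unfold NN Fo FR
  rw [if_neg (by simpa using hab)]
  refine Finset.sum_congr rfl fun g _ => ?_
  congr 1
  apply propext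
  constructor
  · exact fun h => h.2.1
  · exact fun h => ⟨h.1 a (by simp), h, Reach.refl _ _⟩

theorem main_pos {X : Type*} [Fintype X] (s : X × X → ℝ) (hs : ∀ e, 0 < s e) (a b : X)
    (hab : a ≠ b) (x : X) :
    NN s {b} a a * TT s x = TT s a * NN s {b} a x + TT s b * NN s {a} b x := by
  set u : X → ℝ := fun x =>
    NN s {b} a a * TT s x - (TT s a * NN s {b} a x + TT s b * NN s {a} b x) with hu
  have hst : ∀ y, ∑ x, u x * s (x, y) = u y * ∑ z, s (y, z) := by
    intro y
    have hE : ∑ x, u x * s (x, y) = NN s {b} a a * (∑ x, TT s x * s (x, y)) -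
        (TT s a * (∑ x, NN s {b} a x * s (x, y)) + TT s b * ∑ x, NN s {a} b x * s (x, y)) := by
      simp only [hu, Finset.mul_sum, ← Finset.sum_add_distrib, ← Finset.sum_sub_distrib]
      exact Finset.sum_congr rfl fun x _ => by ring
    rw [hE, mctt]
    have hz1 : NN s {b} a b = 0 := by simp [NN]
    have hz2 : NN s {a} b a = 0 := by simp [NN]
    by_cases hya : y = a
    · subst hya
      have b1 := balance s {b} y y (by simpa using hab)
      have b2 := flux s b y hab.symm
      rw [if_pos rfl] at b1
      rw [b2, eq_sub_of_add_eq b1]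
      simp only [hu, hz2, TT]
      ring
    · by_cases hyb : y = b
      · subst hyb
        have b1 := balance s {a} y y (by simpa using hya)
        have b2 := flux s a y hab
        rw [if_pos rfl] at b1
        rw [b2, eq_sub_of_add_eq b1]
        simp only [hu, hz1, TT]
        ring
      · have b1 := balance s {b} y a (by simpa using hyb)
        have b2 := balance s {a} y b (by simpa using hya)
        rw [if_neg hya, add_zero] at b1
        rw [if_neg hyb, add_zero] at b2
        rw [b1, b2]
        simp only [hu]
        ring
  have hua : u a = 0 := by
    have hz2 : NN s {a} b a = 0 := by simp [NN]
    simp only [hu, hz2]; ring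
  have hle : ∀ y ∈ (Finset.univ : Finset X),
      |u y| * ∑ z, s (y, z) ≤ ∑ x, |u x| * s (x, y) := by
    intro y _
    have hp : 0 ≤ ∑ z, s (y, z) := Finset.sum_nonneg fun z _ => (hs _).le
    calc |u y| * ∑ z, s (y, z) = |∑ x, u x * s (x, y)| := by
          rw [hst y, abs_mul, abs_of_nonneg hp]
      _ ≤ ∑ x, |u x * s (x, y)| := Finset.abs_sum_le_sum_abs _ _
      _ = _ := Finset.sum_congr rfl fun x _ => by rw [abs_mul, abs_of_pos (hs _)]
  have hsum : ∑ y, |u y| * ∑ z, s (y, z) = ∑ y, ∑ x, |u x| * s (x, y) := by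
    rw [Finset.sum_comm]
    simp only [Finset.mul_sum]
  have heq := (Finset.sum_eq_sum_iff_of_le hle).1 hsum a (Finset.mem_univ a)
  rw [hua, abs_zero, zero_mul] at heq
  have := (Finset.sum_eq_zero_iff_of_nonneg
    (fun x _ => mul_nonneg (abs_nonneg _) (hs _).le)).1 heq.symm x (Finset.mem_univ x)
  have hux : u x = 0 := by
    rcases mul_eq_zero.1 this with h | h
    · exact abs_eq_zero.1 h
    · exact absurd h (hs _).ne'
  simp only [hu] at hux
  linarith

theorem FR_cont {X : Type*} [Fintype X] (R : Finset X) :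
    Continuous fun s : X × X → ℝ => FR s R := by
  unfold FR W
  refine continuous_finsetSum _ fun g _ => ?_
  split_ifs <;> fun_prop

theorem NN_cont {X : Type*} [Fintype X] (R : Finset X) (a x : X) :
    Continuous fun s : X × X → ℝ => NN s R a x := by
  unfold NN Fo W
  split_ifs
  · fun_prop
  · refine continuous_finsetSum _ fun g _ => ?_
    split_ifs <;> fun_prop

theorem main_nonneg {X : Type*} [Fintype X] (s : X × X → ℝ) (hs : ∀ e, 0 ≤ s e) (a b : X)
    (hab : a ≠ b) (x : X) :
    NN s {b} a a * TT s x = TT s a * NN s {b} a x + TT s b * NN s {a} b x := by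
  have hT : ∀ x : X, Continuous fun s : X × X → ℝ => TT s x := fun x => FR_cont {x}
  have hc1 : Continuous fun s : X × X → ℝ => NN s {b} a a * TT s x :=
    (NN_cont _ _ _).mul (hT _)
  have hc2 : Continuous fun s : X × X → ℝ => TT s a * NN s {b} a x + TT s b * NN s {a} b x :=
    ((hT _).mul (NN_cont _ _ _)).add ((hT _).mul (NN_cont _ _ _))
  have hp : Continuous fun ε : ℝ => (fun e => s e + ε : X × X → ℝ) := by fun_prop
  have t1 := ((hc1.comp hp).tendsto 0).mono_left (nhdsWithin_le_nhds (s := Set.Ioi (0:ℝ)))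
  have t2 := ((hc2.comp hp).tendsto 0).mono_left (nhdsWithin_le_nhds (s := Set.Ioi (0:ℝ)))
  have t3 := t1.congr' (f₂ := _) (by
    filter_upwards [self_mem_nhdsWithin] with ε hε
    exact main_pos (fun e => s e + ε) (fun e => add_pos_of_nonneg_of_pos (hs e) hε) a b hab x)
  have := tendsto_nhds_unique t3 t2
  simpa using this

/-- Restricted rates. -/
def rs {X : Type*} (r : X × X → ℝ) (A B : Set (X × X)) : X × X → ℝ := fun e =>
  if e ∈ A ∨ ∃ z, (e.1, z) ∈ B ∧ z ≠ e.2 then 0 else r e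

theorem rooted_iff {X : Type*} (x : X) (t : X → X) : IsRootedTree x t ↔ For {x} t := by
  simp [IsRootedTree, For, Reach]

theorem tau_eq {X : Type*} [Fintype X] (r : X × X → ℝ) (x : X) (A B : Set (X × X))
    (hB : ∀ z, (x, z) ∉ B) : tau r x A B = TT (rs r A B) x := by
  unfold tau TT FR
  refine Finset.sum_congr rfl fun t _ => ?_
  rw [rooted_iff]
  by_cases hF : For {x} t
  · rw [if_pos hF]
    have hW : treeWeight r x t = W r {x} t := by simp [treeWeight, W]
    by_cases hC : treeEdges x t ∩ A = ∅ ∧ B ⊆ treeEdges x t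
    · rw [if_pos ⟨hF, hC⟩, hW]
      apply W_congr
      intro y hy
      rw [Finset.mem_singleton] at hy
      unfold rs
      rw [if_neg]
      rintro (h | ⟨z, hz, hne⟩)
      · have : (y, t y) ∈ treeEdges x t ∩ A := ⟨⟨hy, rfl⟩, h⟩
        rw [hC.1] at this
        exact this
      · exact hne (hC.2 hz).2
    · rw [if_neg (fun h => hC h.2)]
      symm
      have : ∃ y, y ≠ x ∧ ((y, t y) ∈ A ∨ ∃ z, (y, z) ∈ B ∧ z ≠ t y) := by
        by_contra hcon
        push Not at hcon
        apply hC
        constructor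
        · ext ⟨y, z⟩
          simp only [Set.mem_inter_iff, Set.mem_empty_iff_false, iff_false]
          rintro ⟨⟨h1, h2⟩, h3⟩
          simp only at h1 h2
          subst h2
          exact (hcon y h1).1 h3
        · rintro ⟨y, z⟩ hyz
          have hyx : y ≠ x := by rintro rfl; exact hB z hyz
          exact ⟨hyx, (hcon y hyx).2 z hyz⟩
      obtain ⟨y, hy, hy'⟩ := this
      unfold W
      apply Finset.prod_eq_zero (i := y) (by simpa using hy)
      unfold rs
      exact if_pos hy'
  · rw [if_neg hF, if_neg (fun h => hF h.1)]

theorem tau_zero_root {X : Type*} [Fintype X] (r : X × X → ℝ) (x z : X) (A B : Set (X × X))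
    (hB : (x, z) ∈ B) : tau r x A B = 0 := by
  unfold tau
  refine Finset.sum_eq_zero fun t _ => ?_
  rw [if_neg]
  rintro ⟨_, _, h⟩
  exact (h hB).1 rfl

theorem tau_zero_two {X : Type*} [Fintype X] (r : X × X → ℝ) (x y z w : X) (A B : Set (X × X))
    (hB : (y, z) ∈ B) (hB' : (y, w) ∈ B) (hzw : z ≠ w) : tau r x A B = 0 := by
  unfold tau
  refine Finset.sum_eq_zero fun t _ => ?_
  rw [if_neg]
  rintro ⟨_, _, h⟩
  have h1 := (h hB).2
  have h2 := (h hB').2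
  exact hzw (h1.trans h2.symm)

/-- Trees at `x` using the edge `(b, a)`, in terms of forests. -/
theorem tree_iff {X : Type*} (a b x : X) (hxb : x ≠ b) (h : X → X) (hb : h b = a) :
    For {x} h ↔ For (insert x {b}) (Function.update h b b) ∧
      Reach (Function.update h b b) a x := by
  have hbx : b ∉ ({x} : Finset X) := by simpa using hxb.symm
  have hcomm : (insert x {b} : Finset X) = insert b {x} := Finset.pair_comm x b
  rw [hcomm, for_update h b {x} hbx]
  constructor
  · intro hF
    have hv : ∀ v, Reach h v x := by
      intro v
      obtain ⟨z, hz, hr⟩ := hF.2 v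
      rw [Finset.mem_singleton] at hz
      exact hz ▸ hr
    have hx : h x = x := hF.1 x (by simp)
    refine ⟨⟨hF.1, fun v => ⟨x, by simp, hv v⟩⟩, ?_⟩
    obtain ⟨z, hz, hr⟩ := (reach_update_iff h b b {x, b} (by simp) a).2 ⟨x, by simp, hv a⟩
    simp only [Finset.mem_insert, Finset.mem_singleton] at hz
    rcases hz with rfl | rfl
    · exact hr
    · rw [reach_update_self] at hr
      exact absurd (Reach.cycle hx (by rw [hb]; exact hr) (hv z)) hxb.symm
  · rintro ⟨⟨h1, h2⟩, n, hn⟩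
    have hxx : h x = x := h1 x (by simp)
    have hax : Reach h a x := by
      clear hb
      induction n generalizing a with
      | zero => exact ⟨0, hn⟩
      | succ n ih =>
        by_cases hab : a = b
        · subst hab
          rw [Function.iterate_fixed (by simp)] at hn
          exact absurd hn.symm hxb
        · rw [Function.iterate_succ_apply, Function.update_of_ne hab] at hn
          exact (Reach.step h a).trans (ih (h a) hn)
    refine ⟨h1, fun v => ⟨x, by simp, ?_⟩⟩
    obtain ⟨z, hz, hr⟩ := h2 v
    simp only [Finset.mem_insert, Finset.mem_singleton] at hz
    rcases hz with rfl | rfl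
    · exact hr.trans ((hb ▸ Reach.step h z).trans hax)
    · exact hr

theorem Fo_congr {X : Type*} [Fintype X] (s s' : X × X → ℝ) (R : Finset X) (x a : X)
    (H : ∀ y, y ∉ R → ∀ z, s (y, z) = s' (y, z)) : Fo s R x a = Fo s' R x a := by
  unfold Fo
  refine Finset.sum_congr rfl fun g _ => ?_
  congr 1
  exact W_congr _ _ _ _ _ fun y hy => H y (fun h => hy (Finset.mem_insert_of_mem h)) _

theorem tau_edge {X : Type*} [Fintype X] (r : X × X → ℝ) (a b x : X) (hab : a ≠ b)
    (A B : Set (X × X)) (hA2 : (b, a) ∉ A)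
    (hBb : ∀ z, (b, z) ∉ B) (hBx : ∀ z, (x, z) ∉ B) :
    tau r x (A ∪ {(a, b)}) (B ∪ {(b, a)}) =
      r (b, a) * NN (rs r (A ∪ {(a, b), (b, a)}) B) {b} a x := by
  by_cases hxb : x = b
  · subst hxb
    rw [tau_zero_root r x a _ _ (Or.inr rfl)]
    simp [NN]
  have hBx' : ∀ z, (x, z) ∉ B ∪ {(b, a)} := by
    rintro z (h | h)
    · exact hBx z h
    · rw [Set.mem_singleton_iff, Prod.mk.injEq] at h
      exact hxb h.1
  rw [tau_eq r x _ _ hBx']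
  set s' := rs r (A ∪ {(a, b)}) (B ∪ {(b, a)}) with hs'
  have hsb : s' (b, a) = r (b, a) := by
    simp only [hs', rs]
    rw [if_neg]
    rintro ((h | h) | ⟨z, h | h, hz⟩)
    · exact hA2 h
    · rw [Set.mem_singleton_iff, Prod.mk.injEq] at h
      exact hab h.2
    · exact hBb z h
    · rw [Set.mem_singleton_iff, Prod.mk.injEq] at h
      exact hz h.2
  have hs0 : ∀ z, z ≠ a → s' (b, z) = 0 := by
    intro z hz
    simp only [hs', rs]
    exact if_pos (Or.inr ⟨a, Or.inr rfl, hz.symm⟩)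
  have hss : ∀ y, y ∉ ({b} : Finset X) → ∀ z,
      rs r (A ∪ {(a, b), (b, a)}) B (y, z) = s' (y, z) := by
    intro y hy z
    rw [Finset.mem_singleton] at hy
    simp only [hs', rs]
    congr 1
    simp [hy]
  have hN : NN (rs r (A ∪ {(a, b), (b, a)}) B) {b} a x = Fo s' {b} x a := by
    unfold NN
    rw [if_neg (by simpa using hxb)]
    exact Fo_congr _ _ _ _ _ hss
  rw [hN, mul_comm, ← hsb]
  have hR := reroot s' {x} b a (by simpa using Ne.symm hxb)
    (fun g => For (insert x {b}) g ∧ Reach g a x)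
  have hFo : Fo s' {b} x a = ∑ g : X → X,
      if g b = b ∧ (For (insert x {b}) g ∧ Reach g a x) then W s' (insert b {x}) g else 0 := by
    unfold Fo
    refine Finset.sum_congr rfl fun g _ => ?_
    rw [Finset.pair_comm b x]
    congr 1
    apply propext
    constructor
    · exact fun h => ⟨h.2.1.1 b (by simp), h.2⟩
    · exact fun h => ⟨h.2.1.1 x (by simp), h.2⟩
  rw [hFo]
  refine Eq.trans ?_ (hR.symm.trans (by congr!))
  unfold TT FR
  refine Finset.sum_congr rfl fun h _ => ?_
  by_cases hb : h b = a
  · simp only [← tree_iff a b x hxb h hb]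
    simp [hb]
  · simp only [hb, false_and, if_false]
    split_ifs
    · rw [W_insert s' {x} b (by simpa using Ne.symm hxb), hs0 _ hb, zero_mul]
    · rfl

theorem tau_root_irrel {X : Type*} [Fintype X] (r : X × X → ℝ) (a b : X) (A B : Set (X × X)) :
    tau r b A B = tau r b (A ∪ {(b, a)}) B := by
  unfold tau
  refine Finset.sum_congr rfl fun t _ => ?_
  have : treeEdges b t ∩ (A ∪ {(b, a)}) = treeEdges b t ∩ A := by
    ext ⟨y, z⟩
    simp only [Set.mem_inter_iff, Set.mem_union, Set.mem_singleton_iff, treeEdges,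
      Set.mem_ofPred_eq, Prod.mk.injEq]
    tauto
  rw [this]

theorem stmt_7 {X : Type*} [Fintype X] (r : X × X → ℝ) (hr : ∀ e, 0 ≤ r e)
    (a b : X) (hab : a ≠ b) (hpab : 0 < r (a, b)) (hpba : 0 < r (b, a))
    (A B : Set (X × X)) (hAB : Disjoint A B)
    (hA1 : (a, b) ∉ A) (hA2 : (b, a) ∉ A) (hB1 : (a, b) ∉ B) (hB2 : (b, a) ∉ B)
    (x : X) :
    r (b, a) * tau r b A (B ∪ {(a, b)}) * tau r x (A ∪ {(a, b), (b, a)}) B =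
      r (a, b) * tau r a (A ∪ {(a, b), (b, a)}) B * tau r x (A ∪ {(a, b)}) (B ∪ {(b, a)}) +
      r (b, a) * tau r b (A ∪ {(a, b), (b, a)}) B * tau r x (A ∪ {(b, a)}) (B ∪ {(a, b)}) := by
  have hsw : A ∪ {(b, a), (a, b)} = A ∪ {(a, b), (b, a)} := by rw [Set.pair_comm]
  by_cases hx : ∃ z, (x, z) ∈ B
  · obtain ⟨z, hz⟩ := hx
    rw [tau_zero_root r x z (A ∪ {(a, b), (b, a)}) B hz,
      tau_zero_root r x z _ (B ∪ {(b, a)}) (Or.inl hz),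
      tau_zero_root r x z _ (B ∪ {(a, b)}) (Or.inl hz)]
    ring
  by_cases ha : ∃ z, (a, z) ∈ B
  · obtain ⟨z, hz⟩ := ha
    have hzb : z ≠ b := by rintro rfl; exact hB1 hz
    rw [tau_zero_root r a z _ B hz,
      tau_zero_two r b a z b _ (B ∪ {(a, b)}) (Or.inl hz) (Or.inr rfl) hzb,
      tau_zero_two r x a z b _ (B ∪ {(a, b)}) (Or.inl hz) (Or.inr rfl) hzb]
    ring
  by_cases hb : ∃ z, (b, z) ∈ B
  · obtain ⟨z, hz⟩ := hb
    have hza : z ≠ a := by rintro rfl; exact hB2 hz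
    rw [tau_zero_root r b z A (B ∪ {(a, b)}) (Or.inl hz),
      tau_zero_root r b z _ B hz,
      tau_zero_two r x b z a _ (B ∪ {(b, a)}) (Or.inl hz) (Or.inr rfl) hza]
    ring
  push Not at hx ha hb
  rw [tau_root_irrel r a b A (B ∪ {(a, b)}), tau_edge r a b x hab A B hA2 hb hx,
    tau_edge r b a x hab.symm A B hA1 ha hx, tau_edge r b a b hab.symm A B hA1 ha hb, hsw,
    tau_eq r x _ B hx, tau_eq r a _ B ha, tau_eq r b _ B hb]
  set s := rs r (A ∪ {(a, b), (b, a)}) B with hs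
  have hs0 : ∀ e, 0 ≤ s e := by
    intro e
    simp only [hs, rs]
    split_ifs
    · exact le_rfl
    · exact hr e
  have hm := main_nonneg s hs0 a b hab x
  have hsym : NN s {a} b b = NN s {b} a a := by
    rw [FR_pair s a b hab, FR_pair s b a hab.symm, Finset.pair_comm]
  rw [hsym]
  linear_combination r (a, b) * r (b, a) * hm
end
end

section
/- Stalled value of the affine coefficient: for every ordered pair e = (u,v) of distinct vertices there exists a real number λ¹, independent of p and m, such that j_e(p,m) = j_e(0,0) + λ¹ · j_1(p,m) for all p, m ≥ 0, where j_e(0,0) = (r(u,v)·τ_u^{∖{+1,−1}} − r(v,u)·τ_v^{∖{+1,−1}}) / Σ_{x∈X} τ_x^{∖{+1,−1}} is the stationary current of the reduced graph with the pinned edge removed (here +1 := (a,b), −1 := (b,a)). -/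
open scoped Classical

noncomputable section

/-- The rate function with the pinned rates `r(a,b) = p` and `r(b,a) = m` substituted. -/
def ratePM {X : Type*} (r : X × X → ℝ) (a b : X) (p m : ℝ) : X × X → ℝ :=
  fun e => if e = (a, b) then p else if e = (b, a) then m else r e

/-- The stationary current through the ordered pair `(u,v)`:
`(r(u,v) τ_u − r(v,u) τ_v) / Σ_x τ_x`. -/
def current {X : Type*} [Fintype X] (r : X × X → ℝ) (u v : X) : ℝ :=
  (r (u, v) * tau r u ∅ ∅ - r (v, u) * tau r v ∅ ∅) / ∑ x, tau r x ∅ ∅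

/-- every vertex reaches `x` under iteration of `f` -/
def ReachAll {X : Type*} (f : X → X) (x : X) : Prop := ∀ z, ∃ n : ℕ, f^[n] z = x

lemma reachAll_of_update {X : Type*} (f : X → X) (y c : X)
    (h : ReachAll (Function.update f y c) y) : ReachAll f y := by
  intro z
  obtain ⟨n, hn⟩ := h z
  induction n generalizing z with
  | zero => exact ⟨0, hn⟩
  | succ n ih =>
    by_cases hz : z = y
    · exact ⟨0, hz⟩
    · rw [Function.iterate_succ_apply, Function.update_of_ne hz] at hn
      obtain ⟨k, hk⟩ := ih _ hn
      exact ⟨k + 1, by rwa [Function.iterate_succ_apply]⟩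

lemma reachAll_update_iff {X : Type*} (f : X → X) (y c : X) :
    ReachAll (Function.update f y c) y ↔ ReachAll f y := by
  refine ⟨reachAll_of_update f y c, fun h => ?_⟩
  apply reachAll_of_update _ y (f y)
  simpa using h

lemma tree_update_iff {X : Type*} (f : X → X) (y : X) :
    IsRootedTree y (Function.update f y y) ↔ ReachAll f y := by
  rw [← reachAll_update_iff f y y]
  simp [IsRootedTree, ReachAll]

lemma unique_pred {X : Type*} [Fintype X] (f : X → X) (x : X) :
    (∑ y, if f y = x ∧ ReachAll f y then (1 : ℝ) else 0) = if ReachAll f x then 1 else 0 := by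
  by_cases hx : ReachAll f x
  · rw [if_pos hx]
    obtain ⟨n, hn⟩ := hx (f x)
    have hy : f (f^[n] x) = x := by
      rw [← Function.iterate_succ_apply' f n x, Function.iterate_succ_apply]; exact hn
    have hr : ReachAll f (f^[n] x) := by
      intro z
      obtain ⟨k, hk⟩ := hx z
      exact ⟨n + k, by rw [Function.iterate_add_apply, hk]⟩
    rw [Finset.sum_eq_single (f^[n] x)]
    · rw [if_pos ⟨hy, hr⟩]
    · intro y _ hne
      rw [if_neg]
      rintro ⟨h1, h2⟩
      apply hne
      have per : ∀ w, ReachAll f w → w ∈ Function.periodicPts f := by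
        intro w hw
        obtain ⟨k, hk⟩ := hw (f w)
        exact ⟨k + 1, Nat.succ_pos _, by
          rw [Function.IsPeriodicPt, Function.IsFixedPt, Function.iterate_succ_apply]; exact hk⟩
      exact (Function.bijOn_periodicPts f).injOn (per _ h2) (per _ hr) (h1.trans hy.symm)
    · simp
  · rw [if_neg hx]
    apply Finset.sum_eq_zero
    intro y _
    rw [if_neg]
    rintro ⟨h1, h2⟩
    apply hx
    intro z
    obtain ⟨k, hk⟩ := h2 z
    exact ⟨k + 1, by rw [Function.iterate_succ_apply', hk, h1]⟩

lemma tau_plain {X : Type*} [Fintype X] (r : X × X → ℝ) (x : X) :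
    tau r x ∅ ∅ = ∑ t : X → X, if IsRootedTree x t then treeWeight r x t else 0 := by
  simp [tau]

lemma mul_tau {X : Type*} [Fintype X] (r : X × X → ℝ) (y x : X) :
    r (y, x) * tau r y ∅ ∅ =
      ∑ f : X → X, if f y = x ∧ ReachAll f y then ∏ z, r (z, f z) else 0 := by
  rw [tau_plain, Finset.mul_sum]
  simp only [mul_ite, mul_zero]
  rw [← Finset.sum_filter, ← Finset.sum_filter]
  refine Finset.sum_bij' (fun t _ => Function.update t y x) (fun f _ => Function.update f y y)
    ?_ ?_ ?_ ?_ ?_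
  · intro t ht
    simp only [Finset.mem_filter, Finset.mem_univ, true_and] at ht ⊢
    exact ⟨by simp, (reachAll_update_iff _ _ _).2 ht.2⟩
  · intro f hf
    simp only [Finset.mem_filter, Finset.mem_univ, true_and] at hf ⊢
    exact (tree_update_iff f y).2 hf.2
  · intro t ht
    simp only [Finset.mem_filter, Finset.mem_univ, true_and] at ht ⊢
    rw [Function.update_idem]
    nth_rewrite 2 [← ht.1]
    simp
  · intro f hf
    simp only [Finset.mem_filter, Finset.mem_univ, true_and] at hf ⊢
    rw [Function.update_idem, ← hf.1]
    simp
  · intro t ht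
    rw [treeWeight, Finset.filter_ne', ← Finset.mul_prod_erase _ _ (Finset.mem_univ y)]
    simp only [Function.update_self]
    congr 1
    apply Finset.prod_congr rfl
    intro z hz
    rw [Function.update_of_ne (Finset.ne_of_mem_erase hz)]

/-- Markov chain tree theorem: stationarity. -/
lemma tau_stationary {X : Type*} [Fintype X] (r : X × X → ℝ) (x : X) :
    ∑ y, (r (y, x) * tau r y ∅ ∅ - r (x, y) * tau r x ∅ ∅) = 0 := by
  rw [Finset.sum_sub_distrib, sub_eq_zero]
  simp only [mul_tau]
  rw [Finset.sum_comm, Finset.sum_comm (s := (Finset.univ : Finset X))]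
  apply Finset.sum_congr rfl
  intro f _
  have h1 := unique_pred f x
  have h2 : (∑ y, if f x = y ∧ ReachAll f x then (1 : ℝ) else 0)
      = if ReachAll f x then 1 else 0 := by
    by_cases h : ReachAll f x <;> simp [h]
  have e : ∀ (P : X → Prop) [DecidablePred P], (∑ y, if P y then ∏ z, r (z, f z) else 0)
      = (∏ z, r (z, f z)) * ∑ y, if P y then (1 : ℝ) else 0 := by
    intro P _
    rw [Finset.mul_sum]
    simp
  rw [e (fun y => f y = x ∧ ReachAll f y), e (fun y => f x = y ∧ ReachAll f x), h1, h2]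

lemma tau_nonneg {X : Type*} [Fintype X] (r : X × X → ℝ) (hr : ∀ e, 0 ≤ r e) (x : X) :
    0 ≤ tau r x ∅ ∅ := by
  rw [tau_plain]
  apply Finset.sum_nonneg
  intro t _
  split_ifs
  · exact Finset.prod_nonneg fun _ _ => hr _
  · exact le_rfl

lemma exists_tree {X : Type*} (r : X × X → ℝ) (hirr : Irreducible' r) (x : X) :
    ∃ t, IsRootedTree x t ∧ ∀ y, y ≠ x → 0 < r (y, t y) := by
  have hp : ∀ y, ∃ n : ℕ, ∃ f : ℕ → X,
      f 0 = y ∧ f n = x ∧ ∀ i < n, 0 < r (f i, f (i + 1)) := by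
    intro y
    by_cases h : y = x
    · exact ⟨0, fun _ => x, h.symm, rfl, by simp⟩
    · exact hirr y x h
  have key : ∀ y, ∃ w, (y = x → w = x) ∧
      (y ≠ x → 0 < r (y, w) ∧ Nat.find (hp w) < Nat.find (hp y)) := by
    intro y
    by_cases h : y = x
    · exact ⟨x, fun _ => rfl, fun h' => absurd h h'⟩
    · obtain ⟨f, h0, hn, hs⟩ := Nat.find_spec (hp y)
      have hpos : Nat.find (hp y) ≠ 0 := by
        intro hz
        rw [hz] at hn
        exact h (h0.symm.trans hn)
      refine ⟨f 1, fun h' => absurd h' h, fun _ => ⟨?_, ?_⟩⟩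
      · have := hs 0 (Nat.pos_of_ne_zero hpos)
        rwa [h0] at this
      · have : Nat.find (hp (f 1)) ≤ Nat.find (hp y) - 1 := by
          apply Nat.find_min'
          refine ⟨fun i => f (i + 1), rfl, ?_, ?_⟩
          · show f (Nat.find (hp y) - 1 + 1) = x
            rw [Nat.sub_add_cancel (Nat.pos_of_ne_zero hpos)]; exact hn
          · intro i hi
            exact hs (i + 1) (by omega)
        omega
  choose t ht1 ht2 using key
  refine ⟨t, ⟨ht1 x rfl, ?_⟩, fun y hy => (ht2 y hy).1⟩
  intro y
  induction hN : Nat.find (hp y) using Nat.strong_induction_on generalizing y with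
  | _ N ih =>
    by_cases h : y = x
    · exact ⟨0, h⟩
    · obtain ⟨n, hn⟩ := ih _ (hN ▸ (ht2 y h).2) (t y) rfl
      exact ⟨n + 1, by rwa [Function.iterate_succ_apply]⟩

lemma tau_pos {X : Type*} [Fintype X] (r : X × X → ℝ) (hr : ∀ e, 0 ≤ r e)
    (hirr : Irreducible' r) (x : X) : 0 < tau r x ∅ ∅ := by
  obtain ⟨t, ht, hw⟩ := exists_tree r hirr x
  rw [tau_plain]
  apply Finset.sum_pos'
  · intro t _
    split_ifs
    · exact Finset.prod_nonneg fun _ _ => hr _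
    · exact le_rfl
  · refine ⟨t, Finset.mem_univ _, ?_⟩
    rw [if_pos ht]
    exact Finset.prod_pos fun y hy => hw y (by simpa using hy)

lemma stat_unique {X : Type*} [Fintype X] (r : X × X → ℝ) (hr : ∀ e, 0 ≤ r e)
    (hirr : Irreducible' r) (z : X → ℝ)
    (hz : ∀ x, ∑ y, (r (y, x) * z y - r (x, y) * z x) = 0) (hs : ∑ x, z x = 0) :
    ∀ x, z x = 0 := by
  have hz' : ∀ x, ∑ y, r (y, x) * z y = (∑ y, r (x, y)) * z x := by
    intro x
    have := hz x
    rw [Finset.sum_sub_distrib, sub_eq_zero] at this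
    rw [this, Finset.sum_mul]
  set s : X → ℝ := fun x => max (z x) 0 with hsdef
  have hs0 : ∀ x, 0 ≤ s x := fun x => le_max_right _ _
  have hle : ∀ x, (∑ y, r (x, y)) * s x ≤ ∑ y, r (y, x) * s y := by
    intro x
    rcases le_total (z x) 0 with h | h
    · have : s x = 0 := max_eq_right h
      rw [this, mul_zero]
      exact Finset.sum_nonneg fun y _ => mul_nonneg (hr _) (hs0 _)
    · have : s x = z x := max_eq_left h
      rw [this, ← hz']
      exact Finset.sum_le_sum fun y _ => mul_le_mul_of_nonneg_left (le_max_left _ _) (hr _)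
  have htot : ∑ x, (∑ y, r (x, y)) * s x = ∑ x, ∑ y, r (y, x) * s y := by
    rw [Finset.sum_comm]
    simp only [Finset.sum_mul]
  have heq := (Finset.sum_eq_sum_iff_of_le (fun x _ => hle x)).1 htot
  have step : ∀ x y, 0 < s x → 0 < r (x, y) → 0 < s y := by
    intro x y hx hxy
    have h1 : r (x, y) * s x ≤ ∑ w, r (w, y) * s w :=
      Finset.single_le_sum (f := fun w => r (w, y) * s w)
        (fun w _ => mul_nonneg (hr _) (hs0 _)) (Finset.mem_univ x)
    rw [← heq y (Finset.mem_univ _)] at h1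
    rcases (hs0 y).lt_or_eq with h | h
    · exact h
    · rw [← h, mul_zero] at h1
      exact absurd h1 (not_le.2 (mul_pos hxy hx))
  have hnp : ∀ x, z x ≤ 0 := by
    by_contra! hcon
    obtain ⟨x, hx⟩ := hcon
    have hsx : 0 < s x := lt_max_of_lt_left hx
    have hall : ∀ y, 0 < z y := by
      intro y
      by_cases hxy : x = y
      · exact hxy ▸ hx
      obtain ⟨n, f, h0, hn, hstep⟩ := hirr x y hxy
      have : ∀ i ≤ n, 0 < s (f i) := by
        intro i
        induction i with
        | zero => intro _; rwa [h0]
        | succ i ih => intro hi; exact step _ _ (ih (by omega)) (hstep i (by omega))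
      have h := this n le_rfl
      rw [hn] at h
      rcases lt_max_iff.1 h with h | h
      · exact h
      · exact absurd h (lt_irrefl _)
    have := Finset.sum_pos (fun y _ => hall y) ⟨x, Finset.mem_univ x⟩
    linarith
  intro x
  exact (Finset.sum_eq_zero_iff_of_nonpos (fun y _ => hnp y)).1 hs x (Finset.mem_univ x)

lemma rate_split {X : Type*} (r : X × X → ℝ) (a b : X) (hab : a ≠ b) (p m : ℝ) (x y : X) :
    ratePM r a b p m (x, y) = ratePM r a b 0 0 (x, y)
      + (if x = a then (if y = b then p else 0) else 0)
      + (if x = b then (if y = a then m else 0) else 0) := by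
  have hba := hab.symm
  unfold ratePM
  by_cases h1 : x = a <;> by_cases h2 : y = b <;> by_cases h3 : x = b <;> by_cases h4 : y = a <;>
    simp_all

lemma rate_nonneg {X : Type*} (r : X × X → ℝ) (a b : X)
    (hr : ∀ e, e ≠ (a, b) → e ≠ (b, a) → 0 ≤ r e) (p m : ℝ) (hp : 0 ≤ p) (hm : 0 ≤ m) :
    ∀ e, 0 ≤ ratePM r a b p m e := by
  intro e
  unfold ratePM
  split_ifs with h1 h2
  · exact hp
  · exact hm
  · exact hr e h1 h2

lemma irr_mono {X : Type*} (r : X × X → ℝ) (a b : X)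
    (hirr : Irreducible' (ratePM r a b 0 0)) (p m : ℝ) :
    Irreducible' (ratePM r a b p m) := by
  intro x y hxy
  obtain ⟨n, f, h0, hn, hs⟩ := hirr x y hxy
  refine ⟨n, f, h0, hn, fun i hi => ?_⟩
  have := hs i hi
  unfold ratePM at this ⊢
  split_ifs at this ⊢
  · exact absurd this (lt_irrefl _)
  · exact absurd this (lt_irrefl _)
  · exact this

/-- normalized stationary vector -/
def statVec {X : Type*} [Fintype X] (r : X × X → ℝ) (x : X) : ℝ :=
  tau r x ∅ ∅ / ∑ y, tau r y ∅ ∅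

lemma current_eq {X : Type*} [Fintype X] (r : X × X → ℝ) (u v : X) :
    current r u v = r (u, v) * statVec r u - r (v, u) * statVec r v := by
  unfold current statVec
  ring

lemma statVec_stationary {X : Type*} [Fintype X] (r : X × X → ℝ) (x : X) :
    ∑ y, (r (y, x) * statVec r y - r (x, y) * statVec r x) = 0 := by
  have h := tau_stationary r x
  have : ∑ y, (r (y, x) * statVec r y - r (x, y) * statVec r x)
      = (∑ y, (r (y, x) * tau r y ∅ ∅ - r (x, y) * tau r x ∅ ∅)) / ∑ y, tau r y ∅ ∅ := by
    rw [Finset.sum_div]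
    apply Finset.sum_congr rfl
    intro y _
    unfold statVec
    ring
  rw [this, h, zero_div]

lemma statVec_sum {X : Type*} [Fintype X] (r : X × X → ℝ) (hr : ∀ e, 0 ≤ r e)
    (hirr : Irreducible' r) (a : X) : ∑ x, statVec r x = 1 := by
  unfold statVec
  rw [← Finset.sum_div]
  exact div_self (Finset.sum_pos (fun x _ => tau_pos r hr hirr x) ⟨a, Finset.mem_univ a⟩).ne'

lemma defect {X : Type*} [Fintype X] (r : X × X → ℝ) (a b : X) (hab : a ≠ b) (p m : ℝ) (x : X) :
    ∑ y, (ratePM r a b 0 0 (y, x) * statVec (ratePM r a b p m) y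
        - ratePM r a b 0 0 (x, y) * statVec (ratePM r a b p m) x)
      = current (ratePM r a b p m) a b * ((if x = a then 1 else 0) - (if x = b then 1 else 0)) := by
  have h := statVec_stationary (ratePM r a b p m) x
  have hba := hab.symm
  rw [current_eq]
  generalize statVec (ratePM r a b p m) = q at h ⊢
  have e1 : ratePM r a b p m (a, b) = p := by simp [ratePM]
  have e2 : ratePM r a b p m (b, a) = m := by simp [ratePM, hab, hba]
  rw [e1, e2]
  simp only [rate_split r a b hab p m] at h
  generalize ratePM r a b 0 0 = r0 at h ⊢
  have e : ∑ y, ((if y = a then (if x = b then p else 0) else 0)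
        + (if y = b then (if x = a then m else 0) else 0)) * q y
      - ∑ y, ((if x = a then (if y = b then p else 0) else 0)
        + (if x = b then (if y = a then m else 0) else 0)) * q x
      = -((p * q a - m * q b) * ((if x = a then 1 else 0) - (if x = b then 1 else 0))) := by
    by_cases h1 : x = a <;> by_cases h2 : x = b
    · exact absurd (h1.symm.trans h2) hab
    · subst h1; simp [h2]
    · subst h2; simp [h1]
    · simp [h1, h2]
  rw [← Finset.sum_sub_distrib] at e
  rw [← sub_eq_zero, sub_eq_add_neg, ← e, ← Finset.sum_add_distrib]
  refine Eq.trans ?_ h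
  apply Finset.sum_congr rfl
  intro y _
  ring

lemma tau_avoid {X : Type*} [Fintype X] (r : X × X → ℝ) (A : Set (X × X))
    (hA : ∀ e ∈ A, r e = 0) (x : X) : tau r x A ∅ = tau r x ∅ ∅ := by
  unfold tau
  apply Finset.sum_congr rfl
  intro t _
  by_cases h : treeEdges x t ∩ A = ∅
  · simp [h]
  · obtain ⟨e, he, heA⟩ := Set.nonempty_iff_ne_empty.2 h
    have : treeWeight r x t = 0 := by
      apply Finset.prod_eq_zero (i := e.1)
      · simpa using he.1
      · rw [← he.2]; exact hA e heA
    simp [this]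

theorem stmt_14 {X : Type*} [Fintype X] (r : X × X → ℝ) (a b : X) (hab : a ≠ b)
    (hr : ∀ e, e ≠ (a, b) → e ≠ (b, a) → 0 ≤ r e)
    (hirr : Irreducible' (ratePM r a b 0 0))
    (u v : X) (huv : u ≠ v) :
    current (ratePM r a b 0 0) u v =
      (ratePM r a b 0 0 (u, v) * tau (ratePM r a b 0 0) u {(a, b), (b, a)} ∅
        - ratePM r a b 0 0 (v, u) * tau (ratePM r a b 0 0) v {(a, b), (b, a)} ∅)
        / ∑ x, tau (ratePM r a b 0 0) x {(a, b), (b, a)} ∅ ∧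
    ∃ lam1 : ℝ, ∀ p m : ℝ, 0 ≤ p → 0 ≤ m →
      current (ratePM r a b p m) u v =
        current (ratePM r a b 0 0) u v + lam1 * current (ratePM r a b p m) a b := by
  have hba := hab.symm
  constructor
  · have h0 : ∀ e ∈ ({(a, b), (b, a)} : Set (X × X)), ratePM r a b 0 0 e = 0 := by
      intro e he
      simp only [Set.mem_insert_iff, Set.mem_singleton_iff] at he
      rcases he with rfl | rfl <;> simp [ratePM]
    simp only [tau_avoid _ _ h0]
    rfl
  by_cases c1 : (u, v) = (a, b)
  · obtain ⟨rfl, rfl⟩ := Prod.mk.inj c1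
    refine ⟨1, fun p m _ _ => ?_⟩
    have : current (ratePM r u v 0 0) u v = 0 := by
      rw [current_eq]; simp [ratePM]
    rw [this]; ring
  by_cases c2 : (u, v) = (b, a)
  · obtain ⟨rfl, rfl⟩ := Prod.mk.inj c2
    refine ⟨-1, fun p m _ _ => ?_⟩
    have : current (ratePM r v u 0 0) u v = 0 := by
      rw [current_eq]; simp [ratePM]
    rw [this, current_eq, current_eq]; ring
  have huvr : ∀ p m, ratePM r a b p m (u, v) = ratePM r a b 0 0 (u, v) := by
    intro p m
    simp only [ratePM, if_neg c1, if_neg c2]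
  have hvur : ∀ p m, ratePM r a b p m (v, u) = ratePM r a b 0 0 (v, u) := by
    intro p m
    have c3 : (v, u) ≠ (a, b) := fun h => c2 (by rw [Prod.mk.injEq] at h ⊢; exact h.symm)
    have c4 : (v, u) ≠ (b, a) := fun h => c1 (by rw [Prod.mk.injEq] at h ⊢; exact h.symm)
    simp only [ratePM, if_neg c3, if_neg c4]
  have hr0 := rate_nonneg r a b hr 0 0 le_rfl le_rfl
  have hsum : ∀ p m, 0 ≤ p → 0 ≤ m → ∑ x, statVec (ratePM r a b p m) x = 1 := fun p m hp hm =>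
    statVec_sum _ (rate_nonneg r a b hr p m hp hm) (irr_mono r a b hirr p m) a
  have j0 : current (ratePM r a b 0 0) a b = 0 := by
    rw [current_eq]; simp [ratePM]
  -- proportionality of the deviations
  have key : ∀ p m p' m' c c' : ℝ, 0 ≤ p → 0 ≤ m → 0 ≤ p' → 0 ≤ m' →
      c * current (ratePM r a b p m) a b = c' * current (ratePM r a b p' m') a b →
      ∀ x, c * (statVec (ratePM r a b p m) x - statVec (ratePM r a b 0 0) x)
        - c' * (statVec (ratePM r a b p' m') x - statVec (ratePM r a b 0 0) x) = 0 := by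
    intro p m p' m' c c' hp hm hp' hm' hc
    apply stat_unique _ hr0 hirr
    · intro x
      have d1 := defect r a b hab p m x
      have d2 := defect r a b hab p' m' x
      have d0 := defect r a b hab 0 0 x
      rw [j0, zero_mul] at d0
      obtain ⟨Z, hZ⟩ : ∃ Z, Z = ∑ y, (ratePM r a b 0 0 (y, x) * statVec (ratePM r a b 0 0) y
        - ratePM r a b 0 0 (x, y) * statVec (ratePM r a b 0 0) x) := ⟨_, rfl⟩
      rw [← hZ] at d0
      set D : ℝ := (if x = a then 1 else 0) - (if x = b then 1 else 0)
      have : c * (current (ratePM r a b p m) a b * D) - c * Z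
          - (c' * (current (ratePM r a b p' m') a b * D) - c' * Z) = 0 := by
        rw [d0]
        linear_combination D * hc
      rw [← d1, ← d2] at this
      refine Eq.trans ?_ this
      rw [hZ]
      simp only [Finset.mul_sum, ← Finset.sum_sub_distrib]
      apply Finset.sum_congr rfl
      intro y _
      ring
    · simp only [Finset.sum_sub_distrib, ← Finset.mul_sum, hsum p m hp hm, hsum p' m' hp' hm',
        hsum 0 0 le_rfl le_rfl]
      ring
  by_cases hall : ∀ p m : ℝ, 0 ≤ p → 0 ≤ m → current (ratePM r a b p m) a b = 0
  · refine ⟨0, fun p m hp hm => ?_⟩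
    have k := key p m 0 0 1 0 hp hm le_rfl le_rfl (by rw [hall p m hp hm]; ring)
    rw [current_eq, current_eq _ u v, huvr, hvur]
    linear_combination ratePM r a b 0 0 (u, v) * k u - ratePM r a b 0 0 (v, u) * k v
  · push Not at hall
    obtain ⟨p', m', hp', hm', hj⟩ := hall
    refine ⟨(current (ratePM r a b p' m') u v - current (ratePM r a b 0 0) u v)
      / current (ratePM r a b p' m') a b, fun p m hp hm => ?_⟩
    have k := key p m p' m' _ _ hp hm hp' hm'
      (mul_comm (current (ratePM r a b p' m') a b) (current (ratePM r a b p m) a b))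
    have ku := k u
    have kv := k v
    rw [current_eq _ u v, current_eq _ u v, current_eq _ u v, huvr p m, hvur p m, huvr p' m',
      hvur p' m']
    field_simp
    linear_combination ratePM r a b 0 0 (u, v) * ku - ratePM r a b 0 0 (v, u) * kv
end
end
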